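/- Every counter language is context-sensitive: if L is accepted by a ℤ^k-automaton for some k ≥ 1, then L is accepted by a (nondeterministic) linear bounded automaton. -/

import Mathlib

/-- A `G`-automaton over alphabet `α`: a finite directed graph with a start vertex,
accept vertices, and finitely many edges labeled by `(α ∪ {ε}) × G`. -/
structure GAutomaton (G : Type) [Group G] (α : Type) where
  Q : Type
  [fintypeQ : Fintype Q]
  start : Q
  accept : Set Q
  edges : List (Q × Option α × G × Q)

namespace GAutomaton

variable {G : Type} [Group G] {α : Type}

/-- `Path M q w g q'` : there is a path from `q` to `q'` whose word label is `w`
and whose group label is `g`. -/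
inductive Path (M : GAutomaton G α) : M.Q → List α → G → M.Q → Prop
  | nil (q : M.Q) : Path M q [] 1 q
  | cons {q q' q'' : M.Q} {x : Option α} {g h : G} {w : List α}
      (he : (q, x, g, q') ∈ M.edges) (hp : Path M q' w h q'') :
      Path M q (x.toList ++ w) (g * h) q''

/-- `M` accepts `w` when some start-to-accept path has word label `w` and group label `1`. -/
def Accepts (M : GAutomaton G α) (w : List α) : Prop :=
  ∃ q ∈ M.accept, M.Path M.start w 1 q

/-- The language of a `G`-automaton. -/
def Lang (M : GAutomaton G α) : Language α := { w | M.Accepts w }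

/-- A `G`-automaton is deterministic if it has no `ε`-edges and each state has
at most one outgoing edge per alphabet letter. -/
def Deterministic (M : GAutomaton G α) : Prop :=
  (∀ e ∈ M.edges, e.2.1 ≠ none) ∧
  ∀ e ∈ M.edges, ∀ e' ∈ M.edges, e.1 = e'.1 → e.2.1 = e'.2.1 → e = e'

end GAutomaton

/-- A noncontracting (context-sensitive) grammar over terminal alphabet `T`. -/
structure NoncontractingGrammar (T : Type) where
  NT : Type
  [fintypeNT : Fintype NT]
  start : NT
  acceptsEmpty : Bool
  rules : List (List (Symbol T NT) × List (Symbol T NT))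
  lhs_has_nonterminal : ∀ r ∈ rules, ∃ n : NT, Symbol.nonterminal n ∈ r.1
  noncontracting : ∀ r ∈ rules, r.1.length ≤ r.2.length

namespace NoncontractingGrammar
variable {T : Type}

def Produces (g : NoncontractingGrammar T) (u v : List (Symbol T g.NT)) : Prop :=
  ∃ r ∈ g.rules, ∃ p s, u = p ++ r.1 ++ s ∧ v = p ++ r.2 ++ s

def Derives (g : NoncontractingGrammar T) :
    List (Symbol T g.NT) → List (Symbol T g.NT) → Prop :=
  Relation.ReflTransGen g.Produces

def language (g : NoncontractingGrammar T) : Language T :=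
  { w | (w = [] ∧ g.acceptsEmpty = true) ∨
        (w ≠ [] ∧ g.Derives [Symbol.nonterminal g.start] (w.map Symbol.terminal)) }

end NoncontractingGrammar

/-- A language is context-sensitive if some noncontracting grammar generates it. -/
def Language.IsContextSensitive {T : Type} (L : Language T) : Prop :=
  ∃ g : NoncontractingGrammar T, g.language = L
theorem Multiset.wellQuasiOrderedLE_of_finite (V : Type*) [Finite V] :
    WellQuasiOrderedLE (Multiset V) := by
  classical
  exact (Finsupp.orderIsoMultiset (ι := V)).wellQuasiOrderedLE_iff.1 inferInstance

/-- The additive homomorphism sending a multiset to the product of the images of its elements. -/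
def Multiset.mapProdHom {V A : Type*} [CommGroup A] (φ : V → A) : Multiset V →+ Additive A where
  toFun m := Additive.ofMul (m.map φ).prod
  map_zero' := by simp
  map_add' m n := by simp

theorem Submonoid.FG.comap_mapProdHom {V A : Type*} [Finite V] [CommGroup A] (φ : V → A)
    {D : Submonoid A} (hD : D.FG) :
    ((Submonoid.toAddSubmonoid D).comap (Multiset.mapProdHom φ)).FG := by
  obtain ⟨s, rfl⟩ := hD
  have := Multiset.wellQuasiOrderedLE_of_finite V
  have := Multiset.wellQuasiOrderedLE_of_finite s
  let F := (Multiset.mapProdHom φ).comp (AddMonoidHom.fst (Multiset V) (Multiset s))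
  let K := (Multiset.mapProdHom (Subtype.val : s → A)).comp
    (AddMonoidHom.snd (Multiset V) (Multiset s))
  convert (AddSubmonoid.fg_eqLocusM F K).map (AddMonoidHom.fst (Multiset V) (Multiset s)) using 1
  ext m
  simp only [AddSubmonoid.mem_comap, AddSubmonoid.mem_map]
  constructor
  · intro hm
    obtain ⟨l, hl, h⟩ := Submonoid.exists_multiset_of_mem_closure (s := (s : Set A)) hm
    refine ⟨(m, l.attach.map fun x => ⟨x.1, hl x.1 x.2⟩), ?_, rfl⟩
    change Additive.ofMul (m.map φ).prod =
      Additive.ofMul (Multiset.map Subtype.val (Multiset.map _ l.attach)).prod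
    rw [Multiset.map_map]
    change Additive.ofMul (m.map φ).prod = Additive.ofMul (l.attach.map Subtype.val).prod
    rw [Multiset.attach_map_val, h]
    rfl
  · rintro ⟨⟨m, l⟩, h, rfl⟩
    change Additive.ofMul (m.map φ).prod = Additive.ofMul (Multiset.map _ _).prod at h
    change (m.map φ).prod ∈ Submonoid.closure (s : Set A)
    rw [Additive.ofMul.injective h]
    refine Submonoid.multiset_prod_mem _ _ fun a ha => ?_
    obtain ⟨x, -, rfl⟩ := Multiset.mem_map.1 ha
    exact Submonoid.subset_closure x.2

/-- The words over a finite alphabet whose image in a commutative group lies in a fixed finitely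
generated submonoid are the rearrangements of concatenations of finitely many nonempty words. -/
theorem exists_generating_words {V A : Type*} [Finite V] [CommGroup A] (φ : V → A)
    {D : Submonoid A} (hD : D.FG) :
    ∃ B : List (List V), (∀ b ∈ B, b ≠ []) ∧ ∀ l : List V,
      (l.map φ).prod ∈ D ↔ ∃ bs : List (List V), (∀ b ∈ bs, b ∈ B) ∧ l.Perm bs.flatten := by
  classical
  obtain ⟨T, hT⟩ := Submonoid.FG.comap_mapProdHom φ hD
  have key (l : List V) : (l.map φ).prod ∈ D ↔
      (l : Multiset V) ∈ AddSubmonoid.closure (T : Set (Multiset V)) := by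
    rw [hT, AddSubmonoid.mem_comap]
    change _ ↔ (Multiset.map φ ↑l).prod ∈ D
    simp
  refine ⟨(T.erase 0).toList.map Multiset.toList, ?_, fun l => ?_⟩
  · intro b hb
    obtain ⟨m, hm, rfl⟩ := List.mem_map.1 hb
    simpa using (Finset.mem_erase.1 (Finset.mem_toList.1 hm)).1
  rw [key]
  constructor
  · intro h
    suffices H : ∀ m ∈ AddSubmonoid.closure (T : Set (Multiset V)), ∃ bs : List (List V),
        (∀ b ∈ bs, b ∈ (T.erase 0).toList.map Multiset.toList) ∧
          m = (bs.flatten : Multiset V) by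
      obtain ⟨bs, hbs, e⟩ := H _ h
      exact ⟨bs, hbs, Multiset.coe_eq_coe.1 e⟩
    intro m hm
    induction hm using AddSubmonoid.closure_induction with
    | mem m hm =>
      by_cases h0 : m = 0
      · exact ⟨[], by simp, by simp [h0]⟩
      · exact ⟨[m.toList], by simpa using ⟨m, ⟨h0, hm⟩, rfl⟩, by simp⟩
    | zero => exact ⟨[], by simp, by simp⟩
    | add x y _ _ hx hy =>
      obtain ⟨bx, hx, rfl⟩ := hx
      obtain ⟨b', hy, rfl⟩ := hy
      refine ⟨bx ++ b', fun b hb => ?_, by simp⟩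
      rcases List.mem_append.1 hb with h | h
      exacts [hx b h, hy b h]
  · rintro ⟨bs, hbs, hl⟩
    rw [Multiset.coe_eq_coe.2 hl]
    clear hl
    induction bs with
    | nil => simp
    | cons b bs ih =>
      rw [List.flatten_cons, ← Multiset.coe_add]
      refine add_mem ?_ (ih fun c hc => hbs c (List.mem_cons_of_mem _ hc))
      obtain ⟨m, hm, rfl⟩ := List.mem_map.1 (hbs b List.mem_cons_self)
      rw [Multiset.coe_toList]
      exact AddSubmonoid.subset_closure (Finset.mem_of_mem_erase (Finset.mem_toList.1 hm))

/-- `Chain src tgt x l y`: the edges listed in `l`, with endpoints `src` and `tgt`, form a path from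
`x` to `y`. -/
def Chain {V X : Type*} (src tgt : V → X) : X → List V → X → Prop
  | x, [], y => x = y
  | x, v :: l, y => src v = x ∧ Chain src tgt (tgt v) l y

theorem chain_append {V X : Type*} {src tgt : V → X} {x z : X} {l l' : List V} :
    Chain src tgt x (l ++ l') z ↔ ∃ y, Chain src tgt x l y ∧ Chain src tgt y l' z := by
  induction l generalizing x with
  | nil => simp [Chain]
  | cons v l ih => simp [Chain, ih, and_assoc]

/-- Words obtained by rearranging a concatenation of words from `B`. -/
def Shuffled {V : Type*} (B : List (List V)) (l : List V) : Prop :=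
  ∃ bs : List (List V), (∀ b ∈ bs, b ∈ B) ∧ l.Perm bs.flatten

theorem Shuffled.perm {V : Type*} {B : List (List V)} {l l' : List V} (h : Shuffled B l)
    (p : l'.Perm l) : Shuffled B l' :=
  let ⟨bs, hbs, hp⟩ := h
  ⟨bs, hbs, p.trans hp⟩

theorem Shuffled.append {V : Type*} {B : List (List V)} {b l : List V} (hb : b ∈ B)
    (h : Shuffled B l) : Shuffled B (b ++ l) :=
  let ⟨bs, hbs, hp⟩ := h
  ⟨b :: bs, by simpa using ⟨hb, hbs⟩, by simpa using hp.append_left b⟩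

/-- Nonterminals of the grammar that generates shuffled words: a generator of blocks, tokens, and
two kinds of marked tokens, the leftmost one and the one being read. -/
inductive ShuffleNT (V : Type) : Type
  | start
  | tok (v : V)
  | head (v : V)
  | cursor (v : V)

namespace ShuffleNT

variable {V α X : Type}

instance [Finite V] : Finite (ShuffleNT V) := by
  refine Finite.of_injective (β := Option (Fin 3 × V)) (fun n => match n with
    | start => none
    | tok v => some (0, v)
    | head v => some (1, v)
    | cursor v => some (2, v)) ?_
  intro a b h
  cases a <;> cases b <;> simp_all

/-- An unmarked token as a grammar symbol. -/
abbrev T (v : V) : Symbol α (ShuffleNT V) := .nonterminal (tok v)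

/-- A word of tokens whose first token is marked as the leftmost one. -/
def marked : List V → List (Symbol α (ShuffleNT V))
  | [] => []
  | v :: l => .nonterminal (head v) :: l.map T

/-- The rules of the grammar that generates shuffled words. -/
inductive Rule (lett : V → α) (src tgt : V → X) (I F : Set X) (B : List (List V)) :
    List (Symbol α (ShuffleNT V)) → List (Symbol α (ShuffleNT V)) → Prop
  | extend (b : List V) (hb : b ∈ B) : Rule lett src tgt I F B
      [.nonterminal start] (.nonterminal start :: b.map T)
  | close (b : List V) (hb : b ∈ B) : Rule lett src tgt I F B
      [.nonterminal start] (marked b)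
  | swap (u v : V) : Rule lett src tgt I F B [T u, T v] [T v, T u]
  | swapHead (u v : V) : Rule lett src tgt I F B
      [.nonterminal (head u), T v] [.nonterminal (head v), T u]
  | read (v : V) (hv : src v ∈ I) : Rule lett src tgt I F B
      [.nonterminal (head v)] [.nonterminal (cursor v)]
  | advance (u v : V) (h : src v = tgt u) : Rule lett src tgt I F B
      [.nonterminal (cursor u), T v] [.terminal (lett u), .nonterminal (cursor v)]
  | finish (v : V) (hv : tgt v ∈ F) : Rule lett src tgt I F B
      [.nonterminal (cursor v)] [.terminal (lett v)]

variable {lett : V → α} {src tgt : V → X} {I F : Set X} {B : List (List V)}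

theorem length_marked (b : List V) :
    (marked b : List (Symbol α (ShuffleNT V))).length = b.length := by
  cases b <;> simp [marked]

theorem marked_append {b : List V} (hb : b ≠ []) (l : List V) :
    (marked (b ++ l) : List (Symbol α (ShuffleNT V))) = marked b ++ l.map T := by
  cases b with
  | nil => exact absurd rfl hb
  | cons v b => simp [marked]

theorem Rule.finite [Finite V] [Finite α] :
    {r : List (Symbol α (ShuffleNT V)) × List (Symbol α (ShuffleNT V)) |
      Rule lett src tgt I F B r.1 r.2}.Finite := by
  have : Finite (Symbol α (ShuffleNT V)) := by
    have := Fintype.ofFinite α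
    have := Fintype.ofFinite (ShuffleNT V)
    infer_instance
  have hlen (n : ℕ) := List.finite_length_le (Symbol α (ShuffleNT V)) n
  let n := (B.map List.length).sum + 2
  have hn (b : List V) (hb : b ∈ B) : b.length + 1 ≤ n := by
    have := List.le_sum_of_mem (List.mem_map_of_mem (f := List.length) hb)
    omega
  refine ((hlen n).prod (hlen n)).subset ?_
  rintro ⟨a, b⟩ h
  change Rule lett src tgt I F B a b at h
  cases h with
  | extend b hb => have := hn b hb; simp; omega
  | close b hb => have := hn b hb; simp [length_marked]; omega
  | swap | swapHead | read | advance | finish => simp [n]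

/-- The grammar that generates the labels of chains whose edges are shuffled words over `B`. -/
noncomputable def grammar [Finite V] [Finite α] (lett : V → α) (src tgt : V → X) (I F : Set X)
    (B : List (List V)) (hB : ∀ b ∈ B, b ≠ []) (e : Bool) : NoncontractingGrammar α where
  NT := ShuffleNT V
  fintypeNT := Fintype.ofFinite _
  start := start
  acceptsEmpty := e
  rules := (Rule.finite (lett := lett) (src := src) (tgt := tgt) (I := I) (F := F)
    (B := B)).toFinset.toList
  lhs_has_nonterminal := by
    rintro ⟨_, _⟩ h
    simp only [Finset.mem_toList, Set.Finite.mem_toFinset, Set.mem_ofPred_eq] at h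
    cases h <;> simp
  noncontracting := by
    rintro ⟨_, _⟩ h
    simp only [Finset.mem_toList, Set.Finite.mem_toFinset, Set.mem_ofPred_eq] at h
    cases h with
    | close b hb =>
      have := List.length_pos_of_ne_nil (hB b hb)
      simp [length_marked]; omega
    | extend | swap | swapHead | read | advance | finish => simp

/-- One rewriting step of the shuffle grammar. -/
def Step (lett : V → α) (src tgt : V → X) (I F : Set X) (B : List (List V))
    (u v : List (Symbol α (ShuffleNT V))) : Prop :=
  ∃ x y, Rule lett src tgt I F B x y ∧ ∃ p s, u = p ++ x ++ s ∧ v = p ++ y ++ s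

theorem grammar_derives [Finite V] [Finite α] {hB : ∀ b ∈ B, b ≠ []} {e : Bool} :
    (grammar lett src tgt I F B hB e).Derives =
      Relation.ReflTransGen (Step lett src tgt I F B) := by
  unfold NoncontractingGrammar.Derives
  congr 1
  ext u v
  have (r : List (Symbol α (ShuffleNT V)) × List (Symbol α (ShuffleNT V))) :
      r ∈ (grammar lett src tgt I F B hB e).rules ↔ Rule lett src tgt I F B r.1 r.2 :=
    Finset.mem_toList.trans (Set.Finite.mem_toFinset _)
  exact ⟨fun ⟨r, hr, h⟩ => ⟨r.1, r.2, (this r).1 hr, h⟩,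
    fun ⟨x, y, hr, h⟩ => ⟨(x, y), (this (x, y)).2 hr, h⟩⟩

/-- The sentential forms of the shuffle grammar. -/
inductive Form (lett : V → α) (src tgt : V → X) (I F : Set X) (B : List (List V)) :
    List (Symbol α (ShuffleNT V)) → Prop
  | gen (l : List V) (h : Shuffled B l) : Form lett src tgt I F B
      (.nonterminal start :: l.map T)
  | head (v : V) (l : List V) (h : Shuffled B (v :: l)) : Form lett src tgt I F B
      (.nonterminal (.head v) :: l.map T)
  | cursor (x : X) (hx : x ∈ I) (l : List V) (v : V) (l' : List V) (h : Shuffled B (l ++ v :: l'))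
      (hl : Chain src tgt x l (src v)) : Form lett src tgt I F B
      (l.map (fun v => .terminal (lett v)) ++ .nonterminal (.cursor v) :: l'.map T)
  | done (x : X) (hx : x ∈ I) (l : List V) (y : X) (hy : y ∈ F) (l' : List V)
      (h : Shuffled B (l ++ l')) (hl : Chain src tgt x l y) : Form lett src tgt I F B
      (l.map (fun v => .terminal (lett v)) ++ l'.map T)

theorem terminals_append_eq_append {l : List V} {z p s : List (Symbol α (ShuffleNT V))}
    {n : ShuffleNT V} (h : l.map (fun v => .terminal (lett v)) ++ z = p ++ .nonterminal n :: s) :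
    ∃ p', p = l.map (fun v => .terminal (lett v)) ++ p' ∧ z = p' ++ .nonterminal n :: s := by
  induction l generalizing p with
  | nil => exact ⟨p, by simp, by simpa using h⟩
  | cons v l ih =>
    cases p with
    | nil => simp at h
    | cons c p =>
      simp only [List.map_cons, List.cons_append, List.cons.injEq] at h
      obtain ⟨p', rfl, rfl⟩ := ih h.2
      exact ⟨p', by simp [h.1], rfl⟩

theorem tok_of_tokens {l : List V} {p s : List (Symbol α (ShuffleNT V))}
    {n : ShuffleNT V} (h : l.map T = p ++ .nonterminal n :: s) : ∃ v, n = tok v := by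
  have : Symbol.nonterminal n ∈ l.map (T (α := α)) := by simp [h]
  obtain ⟨v, -, hv⟩ := List.mem_map.1 this
  exact ⟨v, by simpa [T] using hv.symm⟩

theorem marker_unique {l : List V} {l' : List V} {p s : List (Symbol α (ShuffleNT V))}
    {m n : ShuffleNT V} (hn : ∀ v, n ≠ tok v)
    (h : l.map (fun v => .terminal (lett v)) ++ .nonterminal m :: l'.map T =
      p ++ .nonterminal n :: s) :
    p = l.map (fun v => .terminal (lett v)) ∧ m = n ∧ s = l'.map T := by
  obtain ⟨p', rfl, hz⟩ := terminals_append_eq_append h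
  cases p' with
  | nil => simp at hz; simp [hz]
  | cons c p' =>
    simp only [List.cons_append, List.cons.injEq] at hz
    obtain ⟨v, hv⟩ := tok_of_tokens hz.2
    exact absurd hv (hn v)

theorem exists_swap {l : List V} {p s : List (Symbol α (ShuffleNT V))} {u v : V}
    (h : l.map T = p ++ T u :: T v :: s) :
    ∃ l', l.Perm l' ∧ p ++ T v :: T u :: s = l'.map T := by
  obtain ⟨a, b, rfl, rfl, hb⟩ := List.map_eq_append_iff.1 h
  obtain ⟨u', b, rfl, hu, hb⟩ := List.map_eq_cons_iff.1 hb
  obtain ⟨v', b, rfl, hv, rfl⟩ := List.map_eq_cons_iff.1 hb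
  simp only [T, Symbol.nonterminal.injEq, tok.injEq] at hu hv
  subst hu hv
  exact ⟨a ++ v' :: u' :: b, (List.Perm.swap _ _ _).append_left a, by simp⟩

theorem exists_swap_marker {l l' : List V} {p s : List (Symbol α (ShuffleNT V))} {u v : V}
    {m : ShuffleNT V} (hm : ∀ v, m ≠ tok v)
    (h : l.map (fun v => .terminal (lett v)) ++ .nonterminal m :: l'.map T =
      p ++ T u :: T v :: s) :
    ∃ l'', l'.Perm l'' ∧ p ++ T v :: T u :: s =
      l.map (fun v => .terminal (lett v)) ++ .nonterminal m :: l''.map T := by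
  obtain ⟨p', rfl, hz⟩ := terminals_append_eq_append h
  cases p' with
  | nil => simp at hz; exact absurd hz.1 (hm u)
  | cons c p' =>
    simp only [List.cons_append, List.cons.injEq] at hz
    obtain ⟨l'', hp, e⟩ := exists_swap hz.2
    exact ⟨l'', hp, by simp [hz.1, e]⟩

theorem Form.swap {p s z : List (Symbol α (ShuffleNT V))} {u v : V}
    (hz : Form lett src tgt I F B z) (h : z = p ++ T u :: T v :: s) :
    Form lett src tgt I F B (p ++ T v :: T u :: s) := by
  cases hz with
  | gen l hl =>
    obtain ⟨l', hp, e⟩ := exists_swap_marker (lett := lett) (l := []) (by simp) h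
    rw [e]
    exact .gen _ (hl.perm hp.symm)
  | head w l hl =>
    obtain ⟨l', hp, e⟩ := exists_swap_marker (lett := lett) (l := []) (by simp) h
    rw [e]
    exact .head _ _ (hl.perm (hp.symm.cons w))
  | cursor x hx l w l' hl hc =>
    obtain ⟨l'', hp, e⟩ := exists_swap_marker (by simp) h
    rw [e]
    exact .cursor x hx _ _ _ (hl.perm ((hp.symm.cons w).append_left l)) hc
  | done x hx l y hy l' hl hc =>
    obtain ⟨p', rfl, hz⟩ := terminals_append_eq_append h
    obtain ⟨l'', hp, e⟩ := exists_swap hz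
    rw [List.append_assoc, e]
    exact .done x hx _ y hy _ (hl.perm (hp.symm.append_left l)) hc

theorem Form.marker {p s z : List (Symbol α (ShuffleNT V))} {n : ShuffleNT V}
    (hz : Form lett src tgt I F B z) (hn : ∀ v, n ≠ tok v) (h : z = p ++ .nonterminal n :: s) :
    (n = start ∧ p = [] ∧ ∃ l, s = l.map T ∧ Shuffled B l) ∨
    (∃ v l, n = .head v ∧ p = [] ∧ s = l.map T ∧ Shuffled B (v :: l)) ∨
    (∃ x ∈ I, ∃ l v l', n = .cursor v ∧ p = l.map (fun v => .terminal (lett v)) ∧ s = l'.map T ∧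
      Shuffled B (l ++ v :: l') ∧ Chain src tgt x l (src v)) := by
  cases hz with
  | gen l hl =>
    obtain ⟨rfl, rfl, rfl⟩ := marker_unique (lett := lett) (l := []) hn h
    exact .inl ⟨rfl, rfl, l, rfl, hl⟩
  | head w l hl =>
    obtain ⟨rfl, rfl, rfl⟩ := marker_unique (lett := lett) (l := []) hn h
    exact .inr (.inl ⟨w, l, rfl, rfl, rfl, hl⟩)
  | cursor x hx l w l' hl hc =>
    obtain ⟨rfl, rfl, rfl⟩ := marker_unique hn h
    exact .inr (.inr ⟨x, hx, l, w, l', rfl, rfl, rfl, hl, hc⟩)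
  | done x hx l y hy l' hl hc =>
    obtain ⟨p', rfl, hz⟩ := terminals_append_eq_append h
    obtain ⟨v, hv⟩ := tok_of_tokens hz
    exact absurd hv (hn v)

theorem Form.step (hB : ∀ b ∈ B, b ≠ []) {z z' : List (Symbol α (ShuffleNT V))}
    (hz : Form lett src tgt I F B z) (h : Step lett src tgt I F B z z') :
    Form lett src tgt I F B z' := by
  obtain ⟨a, b, hr, p, s, rfl, rfl⟩ := h
  cases hr with
  | extend b hb =>
    have := hz.marker (p := p) (n := start) (s := s) (by simp) (by simp)
    simp only [true_and, reduceCtorEq, false_and, exists_false, and_false, or_false] at this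
    obtain ⟨rfl, l, rfl, hl⟩ := this
    simpa using Form.gen _ (hl.append hb)
  | close b hb =>
    have := hz.marker (p := p) (n := start) (s := s) (by simp) (by simp)
    simp only [true_and, reduceCtorEq, false_and, exists_false, and_false, or_false] at this
    obtain ⟨rfl, l, rfl, hl⟩ := this
    cases b with
    | nil => exact absurd rfl (hB _ hb)
    | cons v b => simpa [marked] using Form.head v (b ++ l) (hl.append hb)
  | swap u v =>
    simpa using hz.swap (p := p) (s := s) (u := u) (v := v) (by simp)
  | swapHead u v =>
    have := hz.marker (p := p) (n := .head u) (s := T v :: s) (by simp) (by simp)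
    simp only [reduceCtorEq, false_and, exists_false, and_false, or_false, false_or,
      head.injEq] at this
    obtain ⟨_, l, rfl, rfl, hs, hl⟩ := this
    obtain ⟨v', l, rfl, hv, rfl⟩ := List.map_eq_cons_iff.1 hs.symm
    simp only [T, Symbol.nonterminal.injEq, tok.injEq] at hv
    subst hv
    exact Form.head _ (_ :: l) (hl.perm (List.Perm.swap _ _ _))
  | read v hv =>
    have := hz.marker (p := p) (n := .head v) (s := s) (by simp) (by simp)
    simp only [reduceCtorEq, false_and, exists_false, and_false, or_false, false_or,
      head.injEq] at this
    obtain ⟨_, l, rfl, rfl, rfl, hl⟩ := this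
    exact Form.cursor _ hv [] v l hl rfl
  | advance u v huv =>
    have := hz.marker (p := p) (n := .cursor u) (s := T v :: s) (by simp) (by simp)
    simp only [reduceCtorEq, false_and, exists_false, false_or, cursor.injEq] at this
    obtain ⟨x, hx, l, _, l', rfl, rfl, hs, hl, hc⟩ := this
    obtain ⟨v', l', rfl, hv, rfl⟩ := List.map_eq_cons_iff.1 hs.symm
    simp only [T, Symbol.nonterminal.injEq, tok.injEq] at hv
    subst hv
    have := Form.cursor (lett := lett) (F := F) x hx (l ++ [u]) v' l' (by simpa using hl)
      (chain_append.2 ⟨_, hc, rfl, huv.symm⟩)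
    simpa using this
  | finish v hv =>
    have := hz.marker (p := p) (n := .cursor v) (s := s) (by simp) (by simp)
    simp only [reduceCtorEq, false_and, exists_false, false_or, cursor.injEq] at this
    obtain ⟨x, hx, l, _, l', rfl, rfl, rfl, hl, hc⟩ := this
    have := Form.done (lett := lett) (F := F) x hx (l ++ [v]) _ hv l' (by simpa using hl)
      (chain_append.2 ⟨_, hc, rfl, rfl⟩)
    simpa using this

theorem Form.of_steps (hB : ∀ b ∈ B, b ≠ []) {z : List (Symbol α (ShuffleNT V))}
    (h : Relation.ReflTransGen (Step lett src tgt I F B) [.nonterminal start] z) :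
    Form lett src tgt I F B z := by
  induction h with
  | refl => exact .gen [] ⟨[], by simp, by simp⟩
  | tail _ hs ih => exact ih.step hB hs

theorem Form.terminal {w : List α}
    (h : Form lett src tgt I F B (w.map .terminal)) :
    ∃ x ∈ I, ∃ y ∈ F, ∃ l, Chain src tgt x l y ∧ Shuffled B l ∧ l.map lett = w := by
  generalize hz : w.map Symbol.terminal = z at h
  have hnt (n : ShuffleNT V) : Symbol.nonterminal n ∉ z := by simp [← hz]
  cases h with
  | gen => exact absurd (by simp) (hnt start)
  | head v => exact absurd (by simp) (hnt (.head v))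
  | cursor _ _ _ v => exact absurd (by simp) (hnt (.cursor v))
  | done x hx l y hy l' hl hc =>
    cases l' with
    | nil =>
      refine ⟨x, hx, y, hy, l, hc, by simpa using hl, ?_⟩
      refine List.map_injective_iff.2 (fun a b h => Symbol.terminal.inj h) (.trans ?_ hz.symm)
      simp
    | cons v l' => exact absurd (by simp) (hnt (tok v))

section Derivations

local notation "Steps" => Relation.ReflTransGen (Step lett src tgt I F B)

theorem steps_context {z z' : List (Symbol α (ShuffleNT V))} (h : Steps z z')
    (p s : List (Symbol α (ShuffleNT V))) : Steps (p ++ z ++ s) (p ++ z' ++ s) := by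
  refine Relation.ReflTransGen.lift (fun z => p ++ z ++ s) ?_ _ _ h
  rintro _ _ ⟨x, y, hr, p', s', rfl, rfl⟩
  exact ⟨x, y, hr, p ++ p', s' ++ s, by simp, by simp⟩

theorem steps_rule {z z' : List (Symbol α (ShuffleNT V))} (h : Rule lett src tgt I F B z z')
    (p s : List (Symbol α (ShuffleNT V))) : Steps (p ++ z ++ s) (p ++ z' ++ s) :=
  .single ⟨z, z', h, p, s, rfl, rfl⟩

theorem steps_tokens_of_perm {l l' : List V} (h : l.Perm l') : Steps (l.map T) (l'.map T) := by
  induction h with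
  | nil => exact .refl
  | cons v _ ih => simpa using steps_context ih [T v] []
  | swap u v l => simpa using steps_rule (.swap v u) [] (l.map T)
  | trans _ _ ih ih' => exact ih.trans ih'

theorem steps_marked_of_perm {l l' : List V} (h : l.Perm l') : Steps (marked l) (marked l') := by
  induction h with
  | nil => exact .refl
  | cons v h _ =>
    simpa [marked] using steps_context (steps_tokens_of_perm h) [.nonterminal (head v)] []
  | swap u v l => simpa [marked] using steps_rule (.swapHead v u) [] (l.map T)
  | trans _ _ ih ih' => exact ih.trans ih'

theorem steps_start {bs : List (List V)} (h : ∀ b ∈ bs, b ∈ B) :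
    Steps [.nonterminal start] (.nonterminal start :: bs.flatten.map T) := by
  induction bs with
  | nil => exact .refl
  | cons b bs ih =>
    refine (ih fun c hc => h c (List.mem_cons_of_mem _ hc)).trans ?_
    simpa using steps_rule (.extend b (h b List.mem_cons_self)) [] (bs.flatten.map T)

theorem steps_cursor {v : V} {l : List V} {y : X} (hy : y ∈ F) (h : Chain src tgt (tgt v) l y) :
    Steps (.nonterminal (cursor v) :: l.map T) ((v :: l).map fun v => .terminal (lett v)) := by
  induction l generalizing v with
  | nil =>
    obtain rfl : tgt v = y := h
    simpa using steps_rule (.finish v hy) [] []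
  | cons u l ih =>
    have h1 : Steps (.nonterminal (cursor v) :: (u :: l).map T)
        (.terminal (lett v) :: .nonterminal (cursor u) :: l.map T) := by
      simpa using steps_rule (.advance v u h.1) [] (l.map T)
    refine h1.trans ?_
    simpa using steps_context (ih h.2) [.terminal (lett v)] []

theorem steps_of_shuffled (hB : ∀ b ∈ B, b ≠ []) {x y : X} (hx : x ∈ I) (hy : y ∈ F) {l : List V}
    (hl : l ≠ []) (hc : Chain src tgt x l y) (hs : Shuffled B l) :
    Steps [.nonterminal start] (l.map fun v => .terminal (lett v)) := by
  obtain ⟨bs, hbs, hp⟩ := hs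
  have h1 : Steps [.nonterminal start] (marked l) := by
    cases bs with
    | nil => exact absurd (by simpa using hp) hl
    | cons b bs =>
      refine (steps_start fun c hc => hbs c (List.mem_cons_of_mem _ hc)).trans
        (.trans ?_ (steps_marked_of_perm hp.symm))
      have hb := hbs b List.mem_cons_self
      rw [List.flatten_cons, marked_append (hB b hb)]
      simpa using steps_rule (.close b hb) [] (bs.flatten.map T)
  cases l with
  | nil => exact absurd rfl hl
  | cons v l =>
    obtain ⟨rfl, hc⟩ := hc
    have h2 : Steps (marked (v :: l)) (.nonterminal (cursor v) :: l.map T) := by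
      simpa [marked] using steps_rule (.read v hx) [] (l.map T)
    exact (h1.trans h2).trans (steps_cursor hy hc)

end Derivations

end ShuffleNT

/-- A language whose nonempty words are the labels of accepting chains of edges that rearrange a
concatenation of words from a finite list is context-sensitive. -/
theorem isContextSensitive_of_shuffled {V α X : Type} [Finite V] [Finite α] (lett : V → α)
    (src tgt : V → X) (I F : Set X) (B : List (List V)) (hB : ∀ b ∈ B, b ≠ []) (L : Language α)
    (hL : ∀ w : List α, w ≠ [] → (w ∈ L ↔
      ∃ x ∈ I, ∃ y ∈ F, ∃ l, Chain src tgt x l y ∧ Shuffled B l ∧ l.map lett = w)) :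
    L.IsContextSensitive := by
  classical
  refine ⟨ShuffleNT.grammar lett src tgt I F B hB (decide ([] ∈ L)), Set.ext fun w => ?_⟩
  by_cases hw : w = []
  · subst hw
    simp only [NoncontractingGrammar.language, Set.mem_ofPred_eq, ne_eq, not_true, false_and,
      or_false, true_and]
    exact decide_eq_true_iff
  · simp only [NoncontractingGrammar.language, Set.mem_ofPred_eq, hw, false_and, ne_eq,
      not_false_eq_true, true_and, false_or, ShuffleNT.grammar_derives]
    refine Iff.trans ⟨fun h => (ShuffleNT.Form.of_steps hB h).terminal, ?_⟩ (hL w hw).symm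
    rintro ⟨x, hx, y, hy, l, hc, hs, rfl⟩
    have := ShuffleNT.steps_of_shuffled (lett := lett) hB hx hy (by simpa using hw) hc hs
    rw [List.map_map]
    exact this

namespace GAutomaton

theorem Path.append {G α : Type} [Group G] {M : GAutomaton G α} {q r s : M.Q} {w w' : List α}
    {g g' : G} (h : M.Path q w g r) (h' : M.Path r w' g' s) :
    M.Path q (w ++ w') (g * g') s := by
  induction h with
  | nil => simpa using h'
  | cons he _ ih =>
    rw [List.append_assoc, mul_assoc]
    exact .cons he (ih h')

theorem Path.of_edge {G α : Type} [Group G] {M : GAutomaton G α} {q r : M.Q} {x : Option α}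
    {e : G} (he : (q, x, e, r) ∈ M.edges) : M.Path q x.toList e r := by
  simpa using Path.cons he (.nil r)

variable {G α : Type} [CommGroup G] {M : GAutomaton G α}

instance (M : GAutomaton G α) : Finite M.Q :=
  have := M.fintypeQ
  inferInstance

/-- A path that keeps track of its length and of the set of vertices visited so far. -/
inductive TracedPath (M : GAutomaton G α) :
    ℕ → Set M.Q × M.Q → List α → G → Set M.Q × M.Q → Prop
  | nil (p : Set M.Q × M.Q) : TracedPath M 0 p [] 1 p
  | snoc {n : ℕ} {p r : Set M.Q × M.Q} {w : List α} {g e : G} {x : Option α} {q : M.Q}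
      (hp : TracedPath M n p w g r) (he : (r.2, x, e, q) ∈ M.edges) :
      TracedPath M (n + 1) p (w ++ x.toList) (g * e) (insert q r.1, q)

theorem TracedPath.append {n m : ℕ} {p r s : Set M.Q × M.Q} {w w' : List α} {g g' : G}
    (h : M.TracedPath n p w g r) (h' : M.TracedPath m r w' g' s) :
    M.TracedPath (n + m) p (w ++ w') (g * g') s := by
  induction h' with
  | nil => simpa using h
  | snoc _ he ih =>
    rw [← List.append_assoc, ← mul_assoc]
    exact (ih h).snoc he

theorem TracedPath.of_edge {p : Set M.Q × M.Q} {x : Option α} {e : G} {q : M.Q}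
    (he : (p.2, x, e, q) ∈ M.edges) : M.TracedPath 1 p x.toList e (insert q p.1, q) := by
  simpa using (TracedPath.nil p).snoc he

theorem TracedPath.toPath {n : ℕ} {p r : Set M.Q × M.Q} {w : List α} {g : G}
    (h : M.TracedPath n p w g r) : M.Path p.2 w g r.2 := by
  induction h with
  | nil => exact .nil _
  | snoc _ he ih => exact ih.append (.of_edge he)

theorem Path.exists_tracedPath {q q' : M.Q} {w : List α} {g : G} (h : M.Path q w g q')
    (T : Set M.Q) : ∃ n S, M.TracedPath n (T, q) w g (S, q') := by
  induction h generalizing T with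
  | nil q => exact ⟨0, T, .nil _⟩
  | @cons q r _ _ _ _ _ he _ ih =>
    obtain ⟨n, S, h⟩ := ih (insert r T)
    exact ⟨1 + n, S, (TracedPath.of_edge (p := (T, q)) he).append h⟩

theorem finite_setOf_label_tracedPath (M : GAutomaton G α) (L : ℕ) :
    {g : G | ∃ n ≤ L, ∃ p w r, M.TracedPath n p w g r}.Finite := by
  induction L with
  | zero =>
    refine (Set.finite_singleton 1).subset ?_
    rintro g ⟨n, hn, p, w, r, h⟩
    cases h with
    | nil => rfl
    | snoc => omega
  | succ L ih =>
    have hE : {e : G | e ∈ M.edges.map fun t => t.2.2.1}.Finite := List.finite_toSet _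
    refine ((Set.finite_singleton 1).union (Set.Finite.image2 (· * ·) ih hE)).subset ?_
    rintro g ⟨n, hn, p, w, r, h⟩
    cases h with
    | nil => exact .inl rfl
    | snoc h he =>
      exact .inr ⟨_, ⟨_, by omega, _, _, _, h⟩, _, List.mem_map_of_mem (f := fun t => t.2.2.1) he,
        rfl⟩

/-- The submonoid generated by the labels of the `ε`-loops of length at most `L` based at vertices
in `S`. -/
def shortLoops (M : GAutomaton G α) (L : ℕ) (S : Set M.Q) : Submonoid G :=
  Submonoid.closure
    {g | ∃ n ≤ L, ∃ p r, p.2 ∈ S ∧ r.2 = p.2 ∧ M.TracedPath n p [] g r}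

theorem shortLoops_fg (M : GAutomaton G α) (L : ℕ) (S : Set M.Q) : (M.shortLoops L S).FG :=
  (Submonoid.fg_iff _).2 ⟨_, rfl, (M.finite_setOf_label_tracedPath L).subset
    fun _ ⟨n, hn, p, r, _, _, h⟩ => ⟨n, hn, p, [], r, h⟩⟩

theorem shortLoops_mono (M : GAutomaton G α) (L : ℕ) {S S' : Set M.Q} (h : S ⊆ S') :
    M.shortLoops L S ≤ M.shortLoops L S' :=
  Submonoid.closure_mono fun _ ⟨n, hn, p, r, hp, hr⟩ => ⟨n, hn, p, r, h hp, hr⟩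

/-- The labels of the `ε`-loops based at `q`. -/
def loops (M : GAutomaton G α) (q : M.Q) : Submonoid G where
  carrier := {g | M.Path q [] g q}
  one_mem' := .nil q
  mul_mem' h h' := h.append h'

theorem shortLoops_le (M : GAutomaton G α) (L : ℕ) (S : Set M.Q) :
    M.shortLoops L S ≤ ⨆ q ∈ S, M.loops q := by
  refine Submonoid.closure_le.2 ?_
  rintro g ⟨n, -, p, r, hp, hr, h⟩
  have := h.toPath
  rw [hr] at this
  exact le_iSup₂ (f := fun q (_ : q ∈ S) => M.loops q) p.2 hp this

theorem TracedPath.path_mul_loops {n : ℕ} {p r : Set M.Q × M.Q} {w : List α} {g h : G}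
    (hp : M.TracedPath n p w g r) (hs : p.1 = {p.2}) (hh : h ∈ ⨆ q ∈ r.1, M.loops q) :
    M.Path p.2 w (g * h) r.2 := by
  induction hp generalizing h with
  | nil p =>
    simp only [hs, Set.mem_singleton_iff, iSup_iSup_eq_left] at hh
    rw [one_mul]
    exact hh
  | @snoc n p r w g e x q hp he ih =>
    rw [iSup_insert] at hh
    obtain ⟨a, ha, b, hb, rfl⟩ := Submonoid.mem_sup.1 hh
    have := ((ih hs hb).append (.of_edge he)).append ha
    rw [List.append_nil] at this
    convert this using 1
    simp only [mul_comm, mul_left_comm]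

/-- A traced path from `p` without `ε`-loops, together with the list of the configurations visited
since the last letter was read. -/
inductive ReducedPath (M : GAutomaton G α) (p : Set M.Q × M.Q) :
    List (Set M.Q × M.Q) → List α → G → Set M.Q × M.Q → Prop
  | nil : ReducedPath M p [p] [] 1 p
  | eps {vs : List (Set M.Q × M.Q)} {w : List α} {g e : G} {r : Set M.Q × M.Q} {q : M.Q}
      (hp : ReducedPath M p vs w g r) (he : (r.2, none, e, q) ∈ M.edges)
      (hq : (insert q r.1, q) ∉ vs) :
      ReducedPath M p ((insert q r.1, q) :: vs) w (g * e) (insert q r.1, q)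
  | letter {vs : List (Set M.Q × M.Q)} {w : List α} {g e : G} {r : Set M.Q × M.Q} {a : α} {q : M.Q}
      (hp : ReducedPath M p vs w g r) (he : (r.2, some a, e, q) ∈ M.edges) :
      ReducedPath M p [(insert q r.1, q)] (w ++ [a]) (g * e) (insert q r.1, q)

theorem ReducedPath.length_le {p r : Set M.Q × M.Q} {vs : List (Set M.Q × M.Q)} {w : List α}
    {g : G} (h : M.ReducedPath p vs w g r) : vs.length ≤ Nat.card (Set M.Q × M.Q) := by
  have hn : vs.Nodup := by
    induction h with
    | nil => simp
    | eps _ _ hq ih => exact List.nodup_cons.2 ⟨hq, ih⟩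
    | letter => simp
  have := Fintype.ofFinite (Set M.Q × M.Q)
  rw [Nat.card_eq_fintype_card]
  exact hn.length_le_card

theorem ReducedPath.exists_split {p r s : Set M.Q × M.Q} {vs : List (Set M.Q × M.Q)} {w : List α}
    {g : G} (h : M.ReducedPath p vs w g r) (hs : s ∈ vs) :
    ∃ vs' g₁ g₂ m, M.ReducedPath p vs' w g₁ s ∧ M.TracedPath m s [] g₂ r ∧ m < vs.length ∧
      g = g₁ * g₂ := by
  induction h with
  | nil =>
    obtain rfl := List.mem_singleton.1 hs
    exact ⟨_, 1, 1, 0, .nil, .nil _, by simp, by simp⟩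
  | eps hp he hq ih =>
    rcases List.mem_cons.1 hs with rfl | hs
    · exact ⟨_, _, 1, 0, hp.eps he hq, .nil _, by simp, by simp⟩
    · obtain ⟨vs', g₁, g₂, m, h₁, h₂, hm, rfl⟩ := ih hs
      exact ⟨vs', g₁, _, m + 1, h₁, h₂.snoc he, by simpa using hm, mul_assoc _ _ _⟩
  | letter hp he =>
    obtain rfl := List.mem_singleton.1 hs
    exact ⟨_, _, 1, 0, hp.letter he, .nil _, by simp, by simp⟩

theorem TracedPath.exists_reducedPath {n L : ℕ} (hL : Nat.card (Set M.Q × M.Q) ≤ L)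
    {p r : Set M.Q × M.Q} {w : List α} {g : G} (h : M.TracedPath n p w g r) :
    ∃ vs g₀, ∃ l ∈ M.shortLoops L r.1, M.ReducedPath p vs w g₀ r ∧ g = g₀ * l := by
  induction h with
  | nil => exact ⟨_, 1, 1, one_mem _, .nil, by simp⟩
  | @snoc n p r w g e x q _ he ih =>
    obtain ⟨vs, g₀, l, hl, hr, rfl⟩ := ih
    have hl' := M.shortLoops_mono L (Set.subset_insert q r.1) hl
    cases x with
    | some a => exact ⟨_, _, l, hl', hr.letter he, mul_right_comm _ _ _⟩
    | none =>
      rw [Option.toList_none, List.append_nil]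
      by_cases hq : (insert q r.1, q) ∈ vs
      · obtain ⟨vs', g₁, g₂, m, h₁, h₂, hm, rfl⟩ := hr.exists_split hq
        refine ⟨vs', g₁, l * (g₂ * e), mul_mem hl' (Submonoid.subset_closure ?_), h₁, ?_⟩
        · exact ⟨m + 1, by have := hr.length_le; omega, _, _, by simp, rfl, h₂.snoc he⟩
        · simp only [mul_comm, mul_left_comm]
      · exact ⟨_, _, l, hl', hr.eps he hq, mul_right_comm _ _ _⟩

/-- A path of length at most `L` reading a single letter, decorated with a set of vertices that the
whole computation is meant to visit. -/
structure Block (M : GAutomaton G α) (L : ℕ) where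
  goal : Set M.Q
  source : Set M.Q × M.Q
  letter : α
  label : G
  target : Set M.Q × M.Q
  exists_path : ∃ n ≤ L, M.TracedPath n source [letter] label target

namespace Block

variable {L : ℕ}

instance [Finite α] : Finite (M.Block L) := by
  have := (M.finite_setOf_label_tracedPath L).to_subtype
  let C := {g : G | ∃ n ≤ L, ∃ p w r, M.TracedPath n p w g r}
  refine Finite.of_injective (β := Set M.Q × (Set M.Q × M.Q) × α × C × (Set M.Q × M.Q))
    (fun t => (t.goal, t.source, t.letter,
      ⟨t.label, let ⟨n, hn, h⟩ := t.exists_path; ⟨n, hn, _, _, _, h⟩⟩, t.target)) ?_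
  rintro ⟨⟩ ⟨⟩ h
  simp only [Prod.mk.injEq, Subtype.mk.injEq] at h
  obtain ⟨rfl, rfl, rfl, rfl, rfl⟩ := h
  rfl

/-- The initial vertex of a block in the graph of configurations with a goal. -/
def src (t : M.Block L) : Set M.Q × Set M.Q × M.Q := (t.goal, t.source)

/-- The terminal vertex of a block in the graph of configurations with a goal. -/
def tgt (t : M.Block L) : Set M.Q × Set M.Q × M.Q := (t.goal, t.target)

open scoped Classical in
/-- The inverse of the label of a block, placed in the coordinate of its goal. -/
noncomputable def weight (t : M.Block L) : Set M.Q → G := Pi.mulSingle t.goal t.label⁻¹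

theorem prod_weight_mem {l : List (M.Block L)} {S : Set M.Q} (hl : ∀ t ∈ l, t.goal = S)
    (D : Set M.Q → Submonoid G) :
    (l.map weight).prod ∈ Submonoid.pi Set.univ D ↔ (l.map label).prod⁻¹ ∈ D S := by
  classical
  have : (l.map weight).prod = Pi.mulSingle S (l.map label).prod⁻¹ := by
    induction l with
    | nil => simp
    | cons t l ih =>
      obtain rfl := hl t List.mem_cons_self
      rw [List.map_cons, List.prod_cons, ih fun t ht => hl t (List.mem_cons_of_mem _ ht),
        List.map_cons, List.prod_cons, mul_inv, Pi.mulSingle_mul, weight]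
  rw [this, Submonoid.mem_pi]
  constructor
  · intro h
    simpa using h S (Set.mem_univ _)
  · intro h S' _
    by_cases hS : S' = S
    · subst hS
      simpa using h
    · simp [hS]

theorem tracedPath_of_chain {x y : Set M.Q × Set M.Q × M.Q} {l : List (M.Block L)}
    (h : Chain src tgt x l y) : y.1 = x.1 ∧ (∀ t ∈ l, t.goal = x.1) ∧
      ∃ n, M.TracedPath n x.2 (l.map letter) (l.map label).prod y.2 := by
  induction l generalizing x with
  | nil =>
    obtain rfl : x = y := h
    exact ⟨rfl, by simp, 0, .nil _⟩
  | cons t l ih =>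
    obtain ⟨rfl, h⟩ := h
    obtain ⟨h₁, h₂, n, h₃⟩ := ih h
    obtain ⟨m, -, h₄⟩ := t.exists_path
    exact ⟨h₁, by simpa using ⟨rfl, h₂⟩, m + n, h₄.append h₃⟩

end Block

theorem ReducedPath.exists_blocks_append {N : ℕ} (hN : Nat.card (Set M.Q × M.Q) ≤ N)
    {p r : Set M.Q × M.Q} {vs : List (Set M.Q × M.Q)} {w : List α} {g : G}
    (h : M.ReducedPath p vs w g r) (S : Set M.Q) :
    (w = [] ∧ ∃ n < vs.length, M.TracedPath n p [] g r) ∨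
    ∃ (l : List (M.Block (2 * N))) (s : Set M.Q × M.Q) (a : α) (e : G) (n : ℕ),
      Chain Block.src Block.tgt (S, p) l (S, s) ∧ n ≤ N + vs.length ∧
      M.TracedPath n s [a] e r ∧ w = l.map Block.letter ++ [a] ∧
      g = (l.map Block.label).prod * e := by
  induction h with
  | nil => exact .inl ⟨rfl, 0, by simp, .nil _⟩
  | eps hp he hq ih =>
    rcases ih with ⟨rfl, n, hn, h⟩ | ⟨l, s, a, e, n, hc, hn, h, rfl, rfl⟩
    · exact .inl ⟨rfl, n + 1, by simpa using hn, h.snoc he⟩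
    · exact .inr ⟨l, s, a, _, n + 1, hc, by simp; omega, h.snoc he, rfl, mul_assoc _ _ _⟩
  | @letter vs w g e r a q hp he ih =>
    have hlen := hp.length_le
    rcases ih with ⟨rfl, n, hn, h⟩ | ⟨l, s, b, e', n, hc, hn, h, rfl, rfl⟩
    · exact .inr ⟨[], p, a, _, n + 1, rfl, by simp; omega, h.snoc he, rfl, by simp⟩
    · let t : M.Block (2 * N) := ⟨S, s, b, e', r, n, by omega, h⟩
      refine .inr ⟨l ++ [t], r, a, e, 1, chain_append.2 ⟨_, hc, rfl, rfl⟩, by simp,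
        .of_edge he, by simp [t], by simp [t]⟩

theorem ReducedPath.exists_blocks {N : ℕ} (hN : Nat.card (Set M.Q × M.Q) ≤ N)
    {p r : Set M.Q × M.Q} {vs : List (Set M.Q × M.Q)} {w : List α} {g : G}
    (h : M.ReducedPath p vs w g r) (hw : w ≠ []) (S : Set M.Q) :
    ∃ l : List (M.Block (2 * N)), Chain Block.src Block.tgt (S, p) l (S, r) ∧
      w = l.map Block.letter ∧ g = (l.map Block.label).prod := by
  rcases h.exists_blocks_append hN S with ⟨rfl, -⟩ | ⟨l, s, b, e', n, hc, hn, h', rfl, rfl⟩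
  · exact absurd rfl hw
  · have hlen := h.length_le
    let t : M.Block (2 * N) := ⟨S, s, b, e', r, n, by omega, h'⟩
    exact ⟨l ++ [t], chain_append.2 ⟨_, hc, rfl, rfl⟩, by simp [t], by simp [t]⟩

/-- The language of an automaton over a commutative group is context-sensitive. -/
theorem isContextSensitive_lang [Finite α] (M : GAutomaton G α) : M.Lang.IsContextSensitive := by
  let N := Nat.card (Set M.Q × M.Q)
  let L := 2 * N
  obtain ⟨B, hB, hgen⟩ := exists_generating_words (Block.weight (M := M) (L := L))
    (Submonoid.FG.pi fun S => M.shortLoops_fg L S)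
  refine isContextSensitive_of_shuffled Block.letter Block.src Block.tgt
    {x | x.2 = ({M.start}, M.start)} {x | x.2.1 = x.1 ∧ x.2.2 ∈ M.accept} B hB _ fun w hw => ?_
  constructor
  · rintro ⟨q, hq, hpath⟩
    obtain ⟨n, S, ht⟩ := hpath.exists_tracedPath {M.start}
    obtain ⟨vs, g, l, hl, hr, hgl⟩ := ht.exists_reducedPath (L := L) (by omega)
    obtain ⟨bl, hc, rfl, rfl⟩ := hr.exists_blocks le_rfl hw S
    refine ⟨_, rfl, (S, S, q), ⟨rfl, hq⟩, bl, hc, (hgen bl).1 ?_, rfl⟩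
    rw [Block.prod_weight_mem (Block.tracedPath_of_chain hc).2.1,
      ← eq_inv_of_mul_eq_one_right hgl.symm]
    exact hl
  · rintro ⟨⟨S, p⟩, hp, ⟨S', T, q⟩, ⟨hT, hq⟩, l, hc, hs, rfl⟩
    obtain ⟨hS, hgoal, n, ht⟩ := Block.tracedPath_of_chain hc
    obtain rfl : p = ({M.start}, M.start) := hp
    obtain rfl : T = S' := hT
    obtain rfl : T = S := hS
    have hmem := (Block.prod_weight_mem hgoal _).1 ((hgen l).2 hs)
    refine ⟨q, hq, ?_⟩
    simpa using ht.path_mul_loops rfl (M.shortLoops_le L _ hmem)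

end GAutomaton

/-- Every counter language is context-sensitive. -/
theorem stmt_9 (k : ℕ) (hk : 1 ≤ k) (α : Type) [Fintype α]
    (M : GAutomaton (Multiplicative (Fin k → ℤ)) α) :
    M.Lang.IsContextSensitive := M.isContextSensitive_lang
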